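/- Let a : [0,∞) → [0,∞) be a right-continuous nondecreasing function and let μ_a be the Borel measure on [0,∞) determined by μ_a([0,u]) = a(u) for all u ≥ 0. Define the right-inverse c(s) = inf{u ∈ [0,∞) : a(u) > s} ∈ [0,∞] (inf ∅ = ∞), and for s > 0 let c(s⁻) = sup_{0≤r<s} c(r) be its left limit. Then for every Borel measurable f : [0,∞) → [0,∞], ∫_{[0,∞)} f(u) dμ_a(u) = ∫_{(0,∞)} 1_{{c(s⁻) < ∞}} f(c(s⁻)) ds, where ds is Lebesgue measure. -/

import Mathlib

open MeasureTheory
open scoped NNReal ENNReal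

/-- The Galois-type relation `c (s⁻) ≤ v ↔ s ≤ a v` for the left limit of the right-inverse. -/
theorem leftLim_right_inverse_le_iff
    {a : ℝ≥0 → ℝ≥0} (ha_mono : Monotone a)
    (ha_rc : ∀ u : ℝ≥0, ContinuousWithinAt a (Set.Ici u) u)
    {c : ℝ → ℝ≥0∞} (hc : ∀ s : ℝ, c s = ⨅ (u : ℝ≥0) (_ : s < (a u : ℝ)), (u : ℝ≥0∞))
    {cl : ℝ → ℝ≥0∞}
    (hcl : ∀ s : ℝ, cl s = ⨆ (r : ℝ) (_ : 0 ≤ r) (_ : r < s), c r)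
    (s : ℝ) (v : ℝ≥0) : cl s ≤ v ↔ s ≤ a v := by
  simp only [hcl, iSup_le_iff]
  constructor
  · intro h
    refine le_of_forall_lt_imp_le_of_dense fun r hr => ?_
    rcases lt_or_ge r 0 with h0 | h0
    · exact h0.le.trans (a v).coe_nonneg
    have key : ∀ w ∈ Set.Ioi v, r ≤ (a w : ℝ) := by
      intro w hw
      have hcw : c r < w := (h r h0 hr).trans_lt (by exact_mod_cast hw)
      simp only [hc, iInf_lt_iff] at hcw
      obtain ⟨u, hu, huw⟩ := hcw
      exact hu.le.trans (by exact_mod_cast ha_mono (by exact_mod_cast huw.le))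
    have hlim : Filter.Tendsto (fun w => (a w : ℝ)) (nhdsWithin v (Set.Ioi v))
        (nhds (a v : ℝ)) :=
      NNReal.tendsto_coe.2 ((ha_rc v).mono Set.Ioi_subset_Ici_self)
    exact ge_of_tendsto hlim (Filter.eventually_of_mem self_mem_nhdsWithin key)
  · intro h r _ hr
    rw [hc]
    exact iInf₂_le v (hr.trans_le h)

/-- The change of variables formula for `[0,∞]`-valued measurable functions. -/
theorem lintegral_eq_lintegral_leftLim_right_inverse
    {a : ℝ≥0 → ℝ≥0} (ha_mono : Monotone a)
    (ha_rc : ∀ u : ℝ≥0, ContinuousWithinAt a (Set.Ici u) u)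
    {μ : Measure ℝ≥0} (hμ : ∀ u : ℝ≥0, μ (Set.Iic u) = (a u : ℝ≥0∞))
    {c : ℝ → ℝ≥0∞} (hc : ∀ s : ℝ, c s = ⨅ (u : ℝ≥0) (_ : s < (a u : ℝ)), (u : ℝ≥0∞))
    {cl : ℝ → ℝ≥0∞}
    (hcl : ∀ s : ℝ, cl s = ⨆ (r : ℝ) (_ : 0 ≤ r) (_ : r < s), c r)
    {f : ℝ≥0 → ℝ≥0∞} (hf : Measurable f) :
    ∫⁻ u, f u ∂μ
      = ∫⁻ s in Set.Ioi (0 : ℝ), (if cl s < ⊤ then f ((cl s).toNNReal) else 0) := by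
  have hcl_mono : Monotone cl := by
    intro s t hst
    rw [hcl, hcl]
    exact iSup_mono fun r => iSup_mono fun _ => iSup_mono' fun h => ⟨h.trans_le hst, le_rfl⟩
  have hcl_meas : Measurable cl := hcl_mono.measurable
  have hg : Measurable fun s => (cl s).toNNReal := hcl_meas.ennreal_toNNReal
  have hS : MeasurableSet {s | cl s < ⊤} := measurableSet_lt hcl_meas measurable_const
  let ν : Measure ℝ≥0 :=
    ((volume.restrict (Set.Ioi (0 : ℝ))).restrict {s | cl s < ⊤}).map fun s => (cl s).toNNReal
  have hν (v : ℝ≥0) : ν (Set.Iic v) = a v := by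
    have hset : ((fun s => (cl s).toNNReal) ⁻¹' Set.Iic v ∩ {s | cl s < ⊤}) ∩ Set.Ioi 0
        = Set.Ioc 0 (a v : ℝ) := by
      ext s
      simp only [Set.mem_inter_iff, Set.mem_preimage, Set.mem_Iic, Set.mem_ofPred_eq,
        Set.mem_Ioi, Set.mem_Ioc]
      constructor
      · rintro ⟨⟨h, hlt⟩, hs⟩
        refine ⟨hs, (leftLim_right_inverse_le_iff ha_mono ha_rc hc hcl s v).1 ?_⟩
        rw [← ENNReal.coe_toNNReal hlt.ne]
        exact_mod_cast h
      · rintro ⟨hs, h⟩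
        have hle := (leftLim_right_inverse_le_iff ha_mono ha_rc hc hcl s v).2 h
        exact ⟨⟨by simpa using ENNReal.toNNReal_mono ENNReal.coe_ne_top hle, hle.trans_lt ENNReal.coe_lt_top⟩, hs⟩
    rw [Measure.map_apply hg measurableSet_Iic, Measure.restrict_apply (hg measurableSet_Iic),
      Measure.restrict_apply ((hg measurableSet_Iic).inter hS), hset, Real.volume_Ioc, sub_zero,
      ENNReal.ofReal_coe_nnreal]
  have hμν : μ = ν := by
    refine Measure.ext_of_generateFrom_of_iUnion (Set.range Set.Iic) (fun n : ℕ => Set.Iic (n : ℝ≥0))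
      (borel_eq_generateFrom_Iic ℝ≥0 ▸ BorelSpace.measurable_eq) isPiSystem_Iic ?_
      (fun n => ⟨_, rfl⟩) (fun n => by simp [hμ]) ?_
    · exact Set.iUnion_eq_univ_iff.2 fun x => exists_nat_ge x
    · rintro _ ⟨v, rfl⟩
      rw [hμ, hν]
  rw [hμν, lintegral_map hf hg, ← lintegral_indicator hS]
  simp only [Set.indicator_apply, Set.mem_ofPred_eq]

/-- Let `a : [0,∞) → [0,∞)` be right-continuous and nondecreasing and let
`μ` be the Borel measure on `[0,∞)` with `μ [0,u] = a u` (the Lebesgue–Stieltjes measure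
of `a`, with an atom of mass `a 0` at `0`).  Let `c s = inf {u : a u > s}` (with values in
`[0,∞]`, `inf ∅ = ∞`) be the right-inverse of `a` and let `c (s⁻) = sup_{0 ≤ r < s} c r`
be its left limit.  Then for every Borel measurable `f : [0,∞) → [0,∞)`,
`∫ f dμ = ∫_(0,∞) 1_{c(s⁻) < ∞} f (c (s⁻)) ds` with `ds` Lebesgue measure. -/
theorem lintegral_stieltjes_eq_lintegral_right_inverse
    (a : ℝ≥0 → ℝ≥0) (ha_mono : Monotone a)
    (ha_rc : ∀ u : ℝ≥0, ContinuousWithinAt a (Set.Ici u) u)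
    (μ : Measure ℝ≥0) (hμ : ∀ u : ℝ≥0, μ (Set.Iic u) = (a u : ℝ≥0∞))
    (c : ℝ → ℝ≥0∞) (hc : ∀ s : ℝ, c s = ⨅ (u : ℝ≥0) (_ : s < (a u : ℝ)), (u : ℝ≥0∞))
    (cl : ℝ → ℝ≥0∞)
    (hcl : ∀ s : ℝ, cl s = ⨆ (r : ℝ) (_ : 0 ≤ r) (_ : r < s), c r)
    (f : ℝ≥0 → ℝ≥0) (hf : Measurable f) :
    ∫⁻ u, (f u : ℝ≥0∞) ∂μ
      = ∫⁻ s in Set.Ioi (0 : ℝ),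
          (if cl s < ⊤ then (f ((cl s).toNNReal) : ℝ≥0∞) else 0) := by
  exact lintegral_eq_lintegral_leftLim_right_inverse ha_mono ha_rc hμ hc hcl
    hf.coe_nnreal_ennreal
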